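/- For all fixed u, v ∈ ℝ, the map ρ ↦ Φ₂(u,v;ρ) is twice differentiable on (-1,1) with second derivative ∂²Φ₂(u,v;ρ)/∂ρ² = ∂φ₂(u,v;ρ)/∂ρ = [φ₂(u,v;ρ)/(1−ρ²)²] · ((1−ρ²)(ρ + uv) − ρ(u² − 2ρuv + v²)). -/

import Mathlib

open MeasureTheory Real

/-- Density of the standard bivariate normal distribution with correlation `ρ`. -/
noncomputable def phi2 (u v ρ : ℝ) : ℝ :=
  (2 * Real.pi * Real.sqrt (1 - ρ ^ 2))⁻¹ *
    Real.exp (-(u ^ 2 - 2 * ρ * u * v + v ^ 2) / (2 * (1 - ρ ^ 2)))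

/-- Distribution function of the standard bivariate normal distribution with correlation `ρ`. -/
noncomputable def Phi2 (u v ρ : ℝ) : ℝ := ∫ s in Set.Iic u, ∫ t in Set.Iic v, phi2 s t ρ

open Set Filter Topology

theorem setIntegral_Iic_comp_sub_div (f : ℝ → ℝ) (v m : ℝ) {σ : ℝ} (hσ : 0 < σ) :
    ∫ t in Iic v, f ((t - m) / σ) = σ * ∫ x in Iic ((v - m) / σ), f x := by
  rw [← integral_indicator measurableSet_Iic, ← integral_indicator measurableSet_Iic]
  have h : (Iic v).indicator (fun t => f ((t - m) / σ)) =
      fun t => (Iic ((v - m) / σ)).indicator f ((t - m) / σ) := by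
    funext t
    simp only [indicator, mem_Iic, div_le_div_iff_of_pos_right hσ, sub_le_sub_iff_right]
  rw [h, integral_sub_right_eq_self (fun t => (Iic ((v - m) / σ)).indicator f (t / σ)) m,
    Measure.integral_comp_div, abs_of_pos hσ, smul_eq_mul]

theorem integrable_exp_neg_sq_div_two : Integrable fun x : ℝ => exp (-x ^ 2 / 2) := by
  convert integrable_exp_neg_mul_sq (b := 1 / 2) (by norm_num) using 3
  ring

theorem integrable_abs_mul_exp_neg_sq_div_two :
    Integrable fun x : ℝ => |x| * exp (-x ^ 2 / 2) := by
  have h := (integrable_mul_exp_neg_mul_sq (b := 1 / 2) (by norm_num)).abs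
  convert h using 2 with x
  rw [abs_mul, abs_of_pos (exp_pos _)]
  ring_nf

theorem hasDerivAt_integral_Iic_exp_neg_sq_div_two (w : ℝ) :
    HasDerivAt (fun y => ∫ x in Iic y, exp (-x ^ 2 / 2)) (exp (-w ^ 2 / 2)) w := by
  have hc : Continuous fun x : ℝ => exp (-x ^ 2 / 2) := by fun_prop
  have h := (intervalIntegral.integral_hasDerivAt_right (hc.intervalIntegrable 0 w)
    (hc.stronglyMeasurableAtFilter _ _) hc.continuousAt).const_add (∫ x in Iic (0 : ℝ), exp (-x ^ 2 / 2))
  refine h.congr_of_eventuallyEq (.of_forall fun y => ?_)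
  beta_reduce
  rw [← intervalIntegral.integral_Iic_sub_Iic integrable_exp_neg_sq_div_two.integrableOn
    integrable_exp_neg_sq_div_two.integrableOn]
  ring

theorem one_sub_sq_pos {ρ : ℝ} (hρ : ρ ∈ Ioo (-1 : ℝ) 1) : 0 < 1 - ρ ^ 2 := by
  nlinarith [hρ.1, hρ.2]

theorem phi2_eq_conditional (s t : ℝ) {ρ : ℝ} (hρ : ρ ∈ Ioo (-1 : ℝ) 1) :
    phi2 s t ρ = (2 * π * √(1 - ρ ^ 2))⁻¹ * exp (-s ^ 2 / 2) *
      exp (-((t - ρ * s) / √(1 - ρ ^ 2)) ^ 2 / 2) := by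
  have h := one_sub_sq_pos hρ
  rw [phi2, mul_assoc _ (exp _), ← exp_add, div_pow, sq_sqrt h.le]
  congr 2
  field_simp
  ring

theorem phi2_nonneg (s t ρ : ℝ) : 0 ≤ phi2 s t ρ := by
  unfold phi2
  positivity

theorem phi2_le (s t : ℝ) {ρ d : ℝ} (hρ : ρ ∈ Ioo (-1 : ℝ) 1) (hd : 0 < d)
    (hdρ : d ≤ 1 - ρ ^ 2) : phi2 s t ρ ≤ (2 * π * √d)⁻¹ * exp (-s ^ 2 / 2) := by
  have hsd : 0 < √d := sqrt_pos.2 hd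
  rw [phi2_eq_conditional s t hρ]
  calc _ ≤ (2 * π * √(1 - ρ ^ 2))⁻¹ * exp (-s ^ 2 / 2) * 1 := by
        gcongr
        rw [exp_le_one_iff]
        nlinarith [sq_nonneg ((t - ρ * s) / √(1 - ρ ^ 2))]
    _ ≤ _ := by
        rw [mul_one]
        gcongr

theorem integral_Iic_phi2 (s v : ℝ) {ρ : ℝ} (hρ : ρ ∈ Ioo (-1 : ℝ) 1) :
    ∫ t in Iic v, phi2 s t ρ =
      (2 * π)⁻¹ * exp (-s ^ 2 / 2) *
        ∫ x in Iic ((v - ρ * s) / √(1 - ρ ^ 2)), exp (-x ^ 2 / 2) := by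
  have h : 0 < √(1 - ρ ^ 2) := sqrt_pos.2 (one_sub_sq_pos hρ)
  simp_rw [phi2_eq_conditional s _ hρ]
  rw [integral_const_mul,
    setIntegral_Iic_comp_sub_div (fun x => exp (-x ^ 2 / 2)) v (ρ * s) h]
  field_simp

theorem hasDerivAt_integral_Iic_phi2 (s v : ℝ) {ρ : ℝ} (hρ : ρ ∈ Ioo (-1 : ℝ) 1) :
    HasDerivAt (fun r => ∫ t in Iic v, phi2 s t r)
      ((ρ * v - s) / (1 - ρ ^ 2) * phi2 s v ρ) ρ := by
  have h := one_sub_sq_pos hρ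
  have hs : 0 < √(1 - ρ ^ 2) := sqrt_pos.2 h
  have hsq : √(1 - ρ ^ 2) ^ 2 = 1 - ρ ^ 2 := sq_sqrt h.le
  have hσ : HasDerivAt (fun r : ℝ => √(1 - r ^ 2)) (-(2 * ρ) / (2 * √(1 - ρ ^ 2))) ρ := by
    have := (((hasDerivAt_id ρ).pow 2).const_sub 1).sqrt h.ne'
    simpa using this
  have hw := (((hasDerivAt_id ρ).mul_const s).const_sub v).div hσ hs.ne'
  have hG := ((hasDerivAt_integral_Iic_exp_neg_sq_div_two
    ((v - ρ * s) / √(1 - ρ ^ 2))).comp ρ hw).const_mul ((2 * π)⁻¹ * exp (-s ^ 2 / 2))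
  have heq : (fun r => ∫ t in Iic v, phi2 s t r) =ᶠ[𝓝 ρ] fun r =>
      (2 * π)⁻¹ * exp (-s ^ 2 / 2) *
        ∫ x in Iic ((v - r * s) / √(1 - r ^ 2)), exp (-x ^ 2 / 2) := by
    filter_upwards [isOpen_Ioo.mem_nhds hρ] with r hr using integral_Iic_phi2 s v hr
  refine (hG.congr_of_eventuallyEq heq).congr_deriv ?_
  rw [phi2_eq_conditional s v hρ]
  simp only [id]
  generalize exp (-((v - ρ * s) / √(1 - ρ ^ 2)) ^ 2 / 2) = E
  generalize √(1 - ρ ^ 2) = σ at hs hsq ⊢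
  rw [← hsq]
  field_simp
  linear_combination -(E * s) * hsq

theorem hasDerivAt_phi2_fst (s v : ℝ) {ρ : ℝ} (hρ : ρ ∈ Ioo (-1 : ℝ) 1) :
    HasDerivAt (fun x => phi2 x v ρ) ((ρ * v - s) / (1 - ρ ^ 2) * phi2 s v ρ) s := by
  have h := one_sub_sq_pos hρ
  have hq : HasDerivAt (fun x : ℝ => -(x ^ 2 - 2 * ρ * x * v + v ^ 2) / (2 * (1 - ρ ^ 2)))
      (-(2 * s - 2 * ρ * v) / (2 * (1 - ρ ^ 2))) s := by
    have := (((((hasDerivAt_id s).pow 2).sub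
      (((hasDerivAt_id s).const_mul (2 * ρ)).mul_const v)).add_const (v ^ 2)).neg).div_const
        (2 * (1 - ρ ^ 2))
    simpa using this
  refine (hq.exp.const_mul (2 * π * √(1 - ρ ^ 2))⁻¹).congr_deriv ?_
  rw [phi2]
  field_simp
  ring

theorem hasDerivAt_phi2_corr (u v : ℝ) {ρ : ℝ} (hρ : ρ ∈ Ioo (-1 : ℝ) 1) :
    HasDerivAt (fun r => phi2 u v r)
      (phi2 u v ρ / (1 - ρ ^ 2) ^ 2 *
        ((1 - ρ ^ 2) * (ρ + u * v) - ρ * (u ^ 2 - 2 * ρ * u * v + v ^ 2))) ρ := by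
  have h := one_sub_sq_pos hρ
  have hs : 0 < √(1 - ρ ^ 2) := sqrt_pos.2 h
  have hsq : √(1 - ρ ^ 2) ^ 2 = 1 - ρ ^ 2 := sq_sqrt h.le
  have hd : HasDerivAt (fun r : ℝ => 1 - r ^ 2) (-(2 * ρ)) ρ := by
    simpa using ((hasDerivAt_id ρ).pow 2).const_sub 1
  have hn : HasDerivAt (fun r : ℝ => -(u ^ 2 - 2 * r * u * v + v ^ 2)) (2 * u * v) ρ := by
    have := ((((((hasDerivAt_id ρ).const_mul 2).mul_const u).mul_const v).const_sub
      (u ^ 2)).add_const (v ^ 2)).neg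
    exact this.congr_deriv (by simp)
  have := (((hd.sqrt h.ne').const_mul (2 * π)).inv (by positivity)).mul
    (hn.div (hd.const_mul 2) (by positivity)).exp
  refine this.congr_deriv ?_
  simp only [phi2, Pi.inv_apply, Pi.div_apply]
  generalize exp (-(u ^ 2 - 2 * ρ * u * v + v ^ 2) / (2 * (1 - ρ ^ 2))) = E
  generalize √(1 - ρ ^ 2) = σ at hs hsq ⊢
  rw [← hsq]
  field_simp
  ring

theorem tendsto_phi2_fst_atBot (v : ℝ) {ρ : ℝ} (hρ : ρ ∈ Ioo (-1 : ℝ) 1) :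
    Tendsto (fun s => phi2 s v ρ) atBot (𝓝 0) := by
  have hq : Tendsto (fun s : ℝ => -s ^ 2 / 2) atBot atBot := by
    have h2 : Tendsto (fun s : ℝ => s ^ 2) atBot atTop := by
      simpa [Function.comp_def, sq_abs] using (tendsto_pow_atTop (α := ℝ) two_ne_zero).comp tendsto_abs_atBot_atTop
    exact (tendsto_neg_atTop_atBot.comp h2).atBot_div_const two_pos
  refine squeeze_zero (fun s => phi2_nonneg s v ρ)
    (fun s => phi2_le s v hρ (one_sub_sq_pos hρ) le_rfl) ?_
  simpa using (tendsto_exp_atBot.comp hq).const_mul (2 * π * √(1 - ρ ^ 2))⁻¹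

theorem abs_mul_phi2_le (s v : ℝ) {ρ d : ℝ} (hρ : ρ ∈ Ioo (-1 : ℝ) 1) (hd : 0 < d)
    (hdρ : d ≤ 1 - ρ ^ 2) :
    ‖(ρ * v - s) / (1 - ρ ^ 2) * phi2 s v ρ‖ ≤
      (|v| + |s|) / d * ((2 * π * √d)⁻¹ * exp (-s ^ 2 / 2)) := by
  rw [norm_mul, norm_div, norm_of_nonneg (phi2_nonneg s v ρ),
    norm_of_nonneg (one_sub_sq_pos hρ).le]
  have hnum : ‖ρ * v - s‖ ≤ |v| + |s| := by
    refine (norm_sub_le _ _).trans ?_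
    rw [norm_mul, Real.norm_eq_abs, Real.norm_eq_abs, Real.norm_eq_abs]
    have := mul_le_of_le_one_left (abs_nonneg v) (abs_lt.2 hρ).le
    linarith
  gcongr
  · exact phi2_nonneg s v ρ
  · exact phi2_le s v hρ hd hdρ

theorem integrable_abs_mul_phi2_bound (v d : ℝ) :
    Integrable fun s : ℝ => (|v| + |s|) / d * ((2 * π * √d)⁻¹ * exp (-s ^ 2 / 2)) := by
  have := ((integrable_exp_neg_sq_div_two.const_mul |v|).add
    integrable_abs_mul_exp_neg_sq_div_two).const_mul (d⁻¹ * (2 * π * √d)⁻¹)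
  convert this using 2 with s
  simp only [Pi.add_apply]
  ring

theorem continuous_phi2_fst (v ρ : ℝ) : Continuous fun s => phi2 s v ρ := by
  unfold phi2
  fun_prop

theorem integral_Iic_deriv_phi2_fst (u v : ℝ) {ρ : ℝ} (hρ : ρ ∈ Ioo (-1 : ℝ) 1) :
    ∫ s in Iic u, (ρ * v - s) / (1 - ρ ^ 2) * phi2 s v ρ = phi2 u v ρ := by
  have hint : Integrable fun s => (ρ * v - s) / (1 - ρ ^ 2) * phi2 s v ρ := by
    refine (integrable_abs_mul_phi2_bound v (1 - ρ ^ 2)).mono' ?_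
      (.of_forall fun s => abs_mul_phi2_le s v hρ (one_sub_sq_pos hρ) le_rfl)
    have := continuous_phi2_fst v ρ
    exact (by fun_prop : Continuous _).aestronglyMeasurable
  rw [integral_Iic_of_hasDerivAt_of_tendsto' (fun s _ => hasDerivAt_phi2_fst s v hρ)
    hint.integrableOn (tendsto_phi2_fst_atBot v hρ), sub_zero]

theorem continuous_integral_Iic_phi2 (v : ℝ) {ρ : ℝ} (hρ : ρ ∈ Ioo (-1 : ℝ) 1) :
    Continuous fun s => ∫ t in Iic v, phi2 s t ρ := by
  simp_rw [integral_Iic_phi2 _ v hρ]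
  have hG : Continuous fun y : ℝ => ∫ x in Iic y, exp (-x ^ 2 / 2) :=
    continuous_iff_continuousAt.2 fun w =>
      (hasDerivAt_integral_Iic_exp_neg_sq_div_two w).continuousAt
  have hw : Continuous fun s : ℝ => (v - ρ * s) / √(1 - ρ ^ 2) := by fun_prop
  exact (by fun_prop : Continuous fun s : ℝ => (2 * π)⁻¹ * exp (-s ^ 2 / 2)).mul (hG.comp hw)

theorem integrable_integral_Iic_phi2 (v : ℝ) {ρ : ℝ} (hρ : ρ ∈ Ioo (-1 : ℝ) 1) :
    Integrable fun s => ∫ t in Iic v, phi2 s t ρ := by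
  refine (integrable_exp_neg_sq_div_two.const_mul
    ((2 * π)⁻¹ * ∫ x : ℝ, exp (-x ^ 2 / 2))).mono'
    (continuous_integral_Iic_phi2 v hρ).aestronglyMeasurable (.of_forall fun s => ?_)
  rw [norm_of_nonneg (integral_nonneg fun t => phi2_nonneg s t ρ), integral_Iic_phi2 s v hρ,
    mul_right_comm]
  have hle := setIntegral_le_integral (s := Iic ((v - ρ * s) / √(1 - ρ ^ 2)))
    integrable_exp_neg_sq_div_two (.of_forall fun x => (exp_pos _).le)
  exact mul_le_mul_of_nonneg_right (mul_le_mul_of_nonneg_left hle (by positivity)) (exp_pos _).le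

theorem hasDerivAt_Phi2_corr (u v : ℝ) {ρ : ℝ} (hρ : ρ ∈ Ioo (-1 : ℝ) 1) :
    HasDerivAt (fun r => Phi2 u v r) (phi2 u v ρ) ρ := by
  obtain ⟨R, hρR, hR1⟩ := exists_between (abs_lt.2 hρ)
  have hR0 : 0 ≤ R := (abs_nonneg ρ).trans hρR.le
  have hd : 0 < 1 - R ^ 2 := one_sub_sq_pos ⟨by linarith, hR1⟩
  have hsub : ∀ r ∈ Ioo (-R) R, r ∈ Ioo (-1 : ℝ) 1 := fun r hr =>
    ⟨by linarith [hr.1], hr.2.trans hR1⟩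
  have hcont := continuous_phi2_fst v ρ
  have hderiv := (hasDerivAt_integral_of_dominated_loc_of_deriv_le
    (μ := volume.restrict (Iic u)) (F := fun r s => ∫ t in Iic v, phi2 s t r)
    (F' := fun r s => (r * v - s) / (1 - r ^ 2) * phi2 s v r)
    (bound := fun s => (|v| + |s|) / (1 - R ^ 2) *
      ((2 * π * √(1 - R ^ 2))⁻¹ * exp (-s ^ 2 / 2)))
    (isOpen_Ioo.mem_nhds (abs_lt.1 hρR))
    (by
      filter_upwards [isOpen_Ioo.mem_nhds hρ] with r hr
      exact (continuous_integral_Iic_phi2 v hr).aestronglyMeasurable)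
    (integrable_integral_Iic_phi2 v hρ).integrableOn
    (by exact (by fun_prop : Continuous _).aestronglyMeasurable)
    (.of_forall fun s r hr => abs_mul_phi2_le s v (hsub r hr) hd
      (by nlinarith [hr.1, hr.2]))
    (integrable_abs_mul_phi2_bound v (1 - R ^ 2)).integrableOn
    (.of_forall fun s r hr => hasDerivAt_integral_Iic_phi2 s v (hsub r hr))).2
  rwa [integral_Iic_deriv_phi2_fst u v hρ] at hderiv

/-- for fixed `u, v`, the map `ρ ↦ Φ₂(u,v;ρ)` is twice differentiable on
`(-1,1)`: its first derivative is `φ₂(u,v;ρ)` and its second derivative equals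
`∂φ₂(u,v;ρ)/∂ρ = [φ₂(u,v;ρ)/(1−ρ²)²] · ((1−ρ²)(ρ + uv) − ρ(u² − 2ρuv + v²))`. -/
theorem Phi2_second_deriv_rho (u v : ℝ) :
    ∀ ρ ∈ Set.Ioo (-1 : ℝ) 1,
      HasDerivAt (fun r => Phi2 u v r) (phi2 u v ρ) ρ ∧
      HasDerivAt (fun r => phi2 u v r)
        (phi2 u v ρ / (1 - ρ ^ 2) ^ 2 *
          ((1 - ρ ^ 2) * (ρ + u * v) - ρ * (u ^ 2 - 2 * ρ * u * v + v ^ 2))) ρ := by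
  intro ρ hρ
  exact ⟨hasDerivAt_Phi2_corr u v hρ, hasDerivAt_phi2_corr u v hρ⟩
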